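/- Let α∈[0,1] be an irrational number of Roth type. For δ>0 define F_δ(x,y)=δ·(x+y)²+δ⁻¹·(x−y)². Then for every a>0 and every ε>0 there exists c>0 such that for all δ∈(0,1): sup_{x,y∈ℝ} Σ_{(k,m)∈ℤ²} e^{−a·F_δ(x+k, y+mα)} ≤ c·δ^{−ε}. -/

import Mathlib

/-- A real number `α` is of Roth type if for every `ε > 0` there is `c > 0` such that
`|α − p/q| ≥ c · q^{−(2+ε)}` for every rational `p/q` with `q ≥ 1`. -/
def IsRothType (α : ℝ) : Prop :=
  ∀ ε > (0 : ℝ), ∃ c > (0 : ℝ), ∀ (p : ℤ) (q : ℕ), 1 ≤ q →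
    c / (q : ℝ) ^ ((2 : ℝ) + ε) ≤ |α - (p : ℝ) / (q : ℝ)|

/-- The quadratic form `F_δ(x,y) = δ(x+y)² + δ⁻¹(x−y)²`. -/
noncomputable def Fdelta (δ x y : ℝ) : ℝ := δ * (x + y) ^ 2 + δ⁻¹ * (x - y) ^ 2

/-- The Gaussian `exp (-b n²)` is summable over the integers. -/
theorem summable_int_exp_neg_mul_sq {b : ℝ} (hb : 0 < b) :
    Summable fun n : ℤ => Real.exp (-b * (n : ℝ) ^ 2) := by
  refine (summable_pow_mul_jacobiTheta₂_term_bound 0 (div_pos hb Real.pi_pos) 0).congr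
    fun n => ?_
  rw [pow_zero, one_mul]
  congr 1
  field_simp
  ring

/-- If the finite subsets of the fibres of `f` have at most `N` elements, then summing `h ≤ g ∘ f`
costs at most a factor `N` compared with summing `g`. -/
theorem tsum_le_mul_tsum_of_card_fiber_le {ι β : Type*} {h : ι → ℝ} {g : β → ℝ} {f : ι → β}
    {N : ℝ} (h_nonneg : ∀ i, 0 ≤ h i) (g_nonneg : ∀ b, 0 ≤ g b) (hg : Summable g)
    (hle : ∀ i, h i ≤ g (f i)) (hN : 0 ≤ N)
    (hcard : ∀ b, ∀ s : Finset ι, (∀ i ∈ s, f i = b) → (s.card : ℝ) ≤ N) :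
    ∑' i, h i ≤ N * ∑' b, g b := by
  classical
  refine Real.tsum_le_of_sum_le h_nonneg fun s => ?_
  calc ∑ i ∈ s, h i ≤ ∑ i ∈ s, g (f i) := Finset.sum_le_sum fun i _ => hle i
    _ = ∑ b ∈ s.image f, ∑ i ∈ s with f i = b, g (f i) :=
      (Finset.sum_fiberwise_of_maps_to (fun i hi => Finset.mem_image_of_mem f hi) _).symm
    _ ≤ ∑ b ∈ s.image f, N * g b := by
      refine Finset.sum_le_sum fun b _ => ?_
      rw [Finset.sum_congr rfl fun i hi => by rw [(Finset.mem_filter.mp hi).2],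
        Finset.sum_const, nsmul_eq_mul]
      exact mul_le_mul_of_nonneg_right
        (hcard b _ fun i hi => (Finset.mem_filter.mp hi).2) (g_nonneg b)
    _ = N * ∑ b ∈ s.image f, g b := by rw [Finset.mul_sum]
    _ ≤ N * ∑' b, g b :=
      mul_le_mul_of_nonneg_left (hg.sum_le_tsum _ fun b _ => g_nonneg b) hN

/-- A finite family of `r`-separated reals in `[A, A + w)` has at most `w / r + 1` members. -/
theorem card_le_of_separated {ι : Type*} {s : Finset ι} {v : ι → ℝ} {A w r : ℝ}
    (hr : 0 < r) (hw : 0 ≤ w) (hlow : ∀ i ∈ s, A ≤ v i) (hup : ∀ i ∈ s, v i < A + w)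
    (hsep : ∀ i ∈ s, ∀ j ∈ s, i ≠ j → r ≤ |v i - v j|) :
    (s.card : ℝ) ≤ w / r + 1 := by
  have hcard : s.card ≤ (Finset.range (⌊w / r⌋₊ + 1)).card := by
    refine Finset.card_le_card_of_injOn (fun i => ⌊(v i - A) / r⌋₊) (fun i hi => ?_)
      fun i hi j hj hij => ?_
    · rw [Finset.coe_range, Set.mem_Iio, Nat.lt_succ_iff]
      exact Nat.floor_le_floor (by gcongr; linarith [hup i hi])
    · by_contra hne
      have hi0 : 0 ≤ (v i - A) / r := div_nonneg (by linarith [hlow i hi]) hr.le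
      have hj0 : 0 ≤ (v j - A) / r := div_nonneg (by linarith [hlow j hj]) hr.le
      have hij' : (⌊(v i - A) / r⌋₊ : ℝ) = ⌊(v j - A) / r⌋₊ := congrArg Nat.cast hij
      have hlt : |(v i - A) / r - (v j - A) / r| < 1 := by
        rw [abs_lt]
        constructor <;>
          linarith [Nat.floor_le hi0, Nat.floor_le hj0, Nat.lt_floor_add_one ((v i - A) / r),
            Nat.lt_floor_add_one ((v j - A) / r)]
      rw [← sub_div, sub_sub_sub_cancel_right, abs_div, abs_of_pos hr, div_lt_one hr] at hlt
      exact absurd (hsep i hi j hj hne) (not_le.mpr hlt)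
  rw [Finset.card_range] at hcard
  calc (s.card : ℝ) ≤ ((⌊w / r⌋₊ + 1 : ℕ) : ℝ) := by exact_mod_cast hcard
    _ ≤ w / r + 1 := by
      push_cast
      linarith [Nat.floor_le (div_nonneg hw hr.le)]

/-- The Roth type inequality as a lower bound for the linear form `k - m α`. -/
theorem IsRothType.exists_le_abs_sub_mul {α : ℝ} (h : IsRothType α) {η : ℝ} (hη : 0 < η) :
    ∃ c > (0 : ℝ), ∀ k m : ℤ, m ≠ 0 → c / |(m : ℝ)| ^ (1 + η) ≤ |(k : ℝ) - m * α| := by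
  obtain ⟨c, hc, H⟩ := h η hη
  have pos : ∀ (p : ℤ) (q : ℕ), 1 ≤ q → c / (q : ℝ) ^ (1 + η) ≤ |(p : ℝ) - q * α| := by
    intro p q hq
    have hq0 : (0 : ℝ) < q := by exact_mod_cast hq
    have hpow : (q : ℝ) ^ (2 + η) = q * (q : ℝ) ^ (1 + η) := by
      rw [show 2 + η = 1 + (1 + η) by ring, Real.rpow_add hq0 1, Real.rpow_one]
    calc c / (q : ℝ) ^ (1 + η) = q * (c / (q : ℝ) ^ (2 + η)) := by
          rw [hpow]; field_simp
      _ ≤ q * |α - p / q| := mul_le_mul_of_nonneg_left (H p q hq) hq0.le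
      _ = |(p : ℝ) - q * α| := by
        rw [← abs_of_pos hq0, ← abs_mul, abs_of_pos hq0, abs_sub_comm (p : ℝ)]
        congr 1
        field_simp
  refine ⟨c, hc, fun k m hm => ?_⟩
  have hq : 1 ≤ m.natAbs := Int.natAbs_pos.mpr hm
  have habs : |(m : ℝ)| = (m.natAbs : ℝ) := by rw [Nat.cast_natAbs, Int.cast_abs]
  rw [habs]
  rcases Int.natAbs_eq m with hm' | hm'
  · have hcast : (m : ℝ) = (m.natAbs : ℝ) := by
      simpa only [Int.cast_natCast] using congrArg (Int.cast (R := ℝ)) hm'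
    rw [hcast]
    exact pos k m.natAbs hq
  · have hcast : (m : ℝ) = -(m.natAbs : ℝ) := by
      simpa only [Int.cast_neg, Int.cast_natCast] using congrArg (Int.cast (R := ℝ)) hm'
    have := pos (-k) m.natAbs hq
    rw [hcast, ← abs_neg]
    convert this using 2
    push_cast
    ring

theorem floor_sq_le (x : ℝ) : (⌊x⌋ : ℝ) ^ 2 ≤ 2 * x ^ 2 + 2 := by
  nlinarith [Int.floor_le x, Int.lt_floor_add_one x, sq_nonneg (2 * x - ⌊x⌋),
    sq_nonneg (x - ⌊x⌋)]

/-- **Lemma (Roth-type lattice sum bound).**  Let `α ∈ [0,1]` be an irrational number of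
Roth type.  Then for every `a > 0` and every `ε > 0` there exists `c > 0` such that for all
`δ ∈ (0,1)`:  `sup_{x,y∈ℝ} Σ_{(k,m)∈ℤ²} exp(−a·F_δ(x+k, y+mα)) ≤ c·δ^{−ε}`. -/
theorem lattice_sum_roth_bound (α : ℝ) (hα : α ∈ Set.Icc (0 : ℝ) 1)
    (hirr : Irrational α) (hroth : IsRothType α) :
    ∀ a > (0 : ℝ), ∀ ε > (0 : ℝ), ∃ c > (0 : ℝ), ∀ δ : ℝ, 0 < δ → δ < 1 →
      ∀ x y : ℝ,
        (∑' km : ℤ × ℤ, Real.exp (-a * Fdelta δ (x + (km.1 : ℝ)) (y + (km.2 : ℝ) * α)))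
          ≤ c * δ ^ (-ε) := by
  intro a ha ε hε
  have hα0 : 0 < α := lt_of_le_of_ne hα.1 hirr.ne_zero.symm
  obtain ⟨c, hc, hsep⟩ := hroth.exists_le_abs_sub_mul (η := 2 * ε) (by positivity)
  have hgauss := summable_int_exp_neg_mul_sq (half_pos ha)
  set G : ℤ × ℤ → ℝ := fun b =>
    Real.exp (2 * a) * (Real.exp (-(a / 2) * (b.1 : ℝ) ^ 2) * Real.exp (-(a / 2) * (b.2 : ℝ) ^ 2))
    with hG
  have G_nonneg : ∀ b, 0 ≤ G b := fun b => by positivity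
  have G_summable : Summable G :=
    (hgauss.mul_of_nonneg hgauss (fun _ => (Real.exp_pos _).le)
      fun _ => (Real.exp_pos _).le).mul_left _
  have hT : 0 ≤ ∑' b, G b := tsum_nonneg G_nonneg
  set K : ℝ := 1 / (c * α ^ (1 + 2 * ε)) with hK
  have hK0 : 0 < K := by positivity
  refine ⟨(K + 1) * (∑' b, G b + 1), by positivity, fun δ hδ0 hδ1 x y => ?_⟩
  set t : ℝ := √δ with ht
  have ht0 : 0 < t := Real.sqrt_pos.mpr hδ0
  have ht2 : t ^ 2 = δ := Real.sq_sqrt hδ0.le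
  have ht1 : t < 1 := by nlinarith
  have hδε : 1 ≤ δ ^ (-ε) :=
    Real.one_le_rpow_of_pos_of_le_one_of_nonpos hδ0 hδ1.le (by linarith)
  let U : ℤ × ℤ → ℝ := fun p => t * (x + p.1 + (y + p.2 * α))
  let V : ℤ × ℤ → ℝ := fun p => (x + p.1 - (y + p.2 * α)) / t
  let r : ℝ := c * (α * t) ^ (1 + 2 * ε) / t
  have hr : 0 < r := by positivity
  have hwr : 1 / r = K * δ ^ (-ε) := by
    have h1 : t ^ (1 + 2 * ε) = t * δ ^ ε := by
      rw [Real.rpow_add ht0, Real.rpow_one, Real.rpow_mul ht0.le, Real.rpow_two, ht2]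
    simp only [r, hK]
    rw [Real.mul_rpow hα0.le ht0.le, h1, Real.rpow_neg hδ0.le]
    field_simp
  have hcard : ∀ b : ℤ × ℤ, ∀ s : Finset (ℤ × ℤ), (∀ p ∈ s, (⌊U p⌋, ⌊V p⌋) = b) →
      (s.card : ℝ) ≤ (K + 1) * δ ^ (-ε) := by
    intro b s hs
    have hU : ∀ p ∈ s, ⌊U p⌋ = b.1 := fun p hp => congrArg Prod.fst (hs p hp)
    have hV : ∀ p ∈ s, ⌊V p⌋ = b.2 := fun p hp => congrArg Prod.snd (hs p hp)
    have h := card_le_of_separated (s := s) (v := V) (A := b.2) (w := 1) hr zero_le_one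
      (fun p hp => (Int.floor_eq_iff.mp (hV p hp)).1)
      (fun p hp => (Int.floor_eq_iff.mp (hV p hp)).2) ?_
    · rw [hwr] at h
      linarith
    intro p hp q hq hne
    have hUd : |U p - U q| < 1 :=
      Int.abs_sub_lt_one_of_floor_eq_floor ((hU p hp).trans (hU q hq).symm)
    have hVd : |V p - V q| < 1 :=
      Int.abs_sub_lt_one_of_floor_eq_floor ((hV p hp).trans (hV q hq).symm)
    have hUe : U p - U q = t * (((p.1 - q.1 : ℤ) : ℝ) + ((p.2 - q.2 : ℤ) : ℝ) * α) := by
      simp only [U]; push_cast; ring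
    have hVe : V p - V q = (((p.1 - q.1 : ℤ) : ℝ) - ((p.2 - q.2 : ℤ) : ℝ) * α) / t := by
      simp only [V]; push_cast; ring
    have hm : p.2 - q.2 ≠ 0 := by
      intro h0
      rw [hVe, h0, Int.cast_zero, zero_mul, sub_zero, abs_div, abs_of_pos ht0,
        div_lt_one ht0] at hVd
      have hk : |p.1 - q.1| < 1 := by exact_mod_cast hVd.trans ht1
      exact hne (Prod.ext (sub_eq_zero.mp (Int.abs_lt_one_iff.mp hk)) (sub_eq_zero.mp h0))
    have hlow := hsep (p.1 - q.1) (p.2 - q.2) hm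
    rw [hUe, abs_mul, abs_of_pos ht0] at hUd
    rw [hVe, abs_div, abs_of_pos ht0] at hVd ⊢
    rw [div_lt_one ht0] at hVd
    generalize ((p.1 - q.1 : ℤ) : ℝ) = k at *
    have hm0 : 0 < |((p.2 - q.2 : ℤ) : ℝ)| := abs_pos.mpr (Int.cast_ne_zero.mpr hm)
    generalize ((p.2 - q.2 : ℤ) : ℝ) = m at *
    have hmle : |m| ≤ 1 / (α * t) := by
      have h2 : 2 * (|m| * α) ≤ |k + m * α| + |k - m * α| := by
        rw [← abs_of_pos hα0, ← abs_mul, abs_of_pos hα0]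
        calc 2 * |m * α| = |(k + m * α) - (k - m * α)| := by
              rw [show k + m * α - (k - m * α) = 2 * (m * α) by ring, abs_mul 2, abs_two]
          _ ≤ _ := abs_sub _ _
      rw [le_div_iff₀ (by positivity)]
      nlinarith
    refine div_le_div_of_nonneg_right (le_trans ?_ hlow) ht0.le
    rw [le_div_iff₀ (by positivity), mul_assoc, ← Real.mul_rpow (by positivity) hm0.le]
    refine mul_le_of_le_one_right hc.le (Real.rpow_le_one (by positivity) ?_ (by positivity))
    rw [le_div_iff₀ (by positivity)] at hmle
    linarith
  have hle : ∀ p : ℤ × ℤ,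
      Real.exp (-a * Fdelta δ (x + (p.1 : ℝ)) (y + (p.2 : ℝ) * α)) ≤ G (⌊U p⌋, ⌊V p⌋) := by
    intro p
    have hF : Fdelta δ (x + (p.1 : ℝ)) (y + (p.2 : ℝ) * α) = U p ^ 2 + V p ^ 2 := by
      simp only [Fdelta, U, V]
      rw [mul_pow, div_pow, ht2]
      ring
    rw [hF]
    simp only [hG]
    rw [← Real.exp_add, ← Real.exp_add, Real.exp_le_exp]
    nlinarith [mul_le_mul_of_nonneg_left (floor_sq_le (U p)) ha.le,
      mul_le_mul_of_nonneg_left (floor_sq_le (V p)) ha.le]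
  calc _ ≤ (K + 1) * δ ^ (-ε) * ∑' b, G b :=
        tsum_le_mul_tsum_of_card_fiber_le (fun _ => (Real.exp_pos _).le) G_nonneg G_summable hle
          (by positivity) hcard
    _ ≤ (K + 1) * δ ^ (-ε) * (∑' b, G b + 1) := by
      gcongr
      linarith
    _ = _ := by ring
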